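/- Let A, B be n×n positive definite complex matrices, N ∈ ℕ and 0 ≤ ν ≤ 1. With α_j(ν) = k_j(ν)/2^{j−1}, the inequality A #_ν B + ∑_{j=1}^{N} s_j(ν) ( A #_{α_j(ν)} B + A #_{2^{1−j}+α_j(ν)} B − 2 A #_{2^{−j}+α_j(ν)} B ) ≤ A ∇_ν B holds in the Loewner order. -/

import Mathlib

open Real Finset

noncomputable def kj (j : ℕ) (ν : ℝ) : ℤ := ⌊(2:ℝ)^(j-1) * ν⌋

noncomputable def rj (j : ℕ) (ν : ℝ) : ℤ := ⌊(2:ℝ)^j * ν⌋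

noncomputable def sj (j : ℕ) (ν : ℝ) : ℝ :=
  (-1:ℝ)^(rj j ν) * (2:ℝ)^(j-1) * ν
    + (-1:ℝ)^(rj j ν + 1) * (⌊((rj j ν : ℝ) + 1)/2⌋ : ℤ)

noncomputable def SS (N : ℕ) (ν a b : ℝ) : ℝ :=
  ∑ j ∈ Finset.Icc 1 N, sj j ν *
    ((b ^ ((2:ℝ)^(j-1) - (kj j ν : ℝ)) * a ^ ((kj j ν : ℝ))) ^ ((1:ℝ)/2^j)
      - (a ^ ((kj j ν : ℝ) + 1) * b ^ ((2:ℝ)^(j-1) - (kj j ν : ℝ) - 1)) ^ ((1:ℝ)/2^j))^2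

open scoped ComplexOrder

noncomputable def mpow {n : Type*} [Fintype n] [DecidableEq n]
    (A : Matrix n n ℂ) (t : ℝ) : Matrix n n ℂ :=
  cfc (fun x : ℝ => x ^ t) A

noncomputable def gm {n : Type*} [Fintype n] [DecidableEq n]
    (A B : Matrix n n ℂ) (t : ℝ) : Matrix n n ℂ :=
  mpow A (1/2) * mpow (mpow A (-(1/2)) * B * mpow A (-(1/2))) t * mpow A (1/2)

noncomputable def hsNorm {n : Type*} [Fintype n] (X : Matrix n n ℂ) : ℝ :=
  Real.sqrt (∑ i, ∑ j, ‖X i j‖^2)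

open scoped MatrixOrder

/-- Linear interpolation of `f` on the dyadic grid of mesh `2⁻ᴺ`, evaluated at `ν`. -/
noncomputable def dyadicInterp {E : Type*} [AddCommGroup E] [Module ℝ E]
    (f : ℝ → E) (N : ℕ) (ν : ℝ) : E :=
  (1 - Int.fract ((2:ℝ)^N * ν)) • f ((⌊(2:ℝ)^N * ν⌋ : ℝ) / 2^N)
    + Int.fract ((2:ℝ)^N * ν) • f (((⌊(2:ℝ)^N * ν⌋ : ℝ) + 1) / 2^N)

lemma dyadicInterp_sub_succ {E : Type*} [AddCommGroup E] [Module ℝ E]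
    (f : ℝ → E) (m : ℕ) (ν : ℝ) :
    dyadicInterp f m ν - dyadicInterp f (m + 1) ν
      = sj (m + 1) ν • (f ((kj (m + 1) ν : ℝ)/2^(m + 1 - 1))
            + f ((2:ℝ)^((1:ℤ) - (m + 1 : ℕ)) + (kj (m + 1) ν : ℝ)/2^(m + 1 - 1))
            - (2:ℝ) • f ((2:ℝ)^(-((m + 1 : ℕ):ℤ)) + (kj (m + 1) ν : ℝ)/2^(m + 1 - 1))) := by
  have e1 : (2:ℝ)^((1:ℤ) - (m + 1 : ℕ)) = 1 / 2^m := by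
    rw [show (1:ℤ) - (m + 1 : ℕ) = -(m : ℤ) by push_cast; ring, zpow_neg, zpow_natCast, one_div]
  have e2 : (2:ℝ)^(-((m + 1 : ℕ):ℤ)) = 1 / 2^(m+1) := by
    rw [zpow_neg, zpow_natCast, one_div]
  unfold dyadicInterp sj kj rj
  rw [e1, e2]
  simp only [Nat.add_sub_cancel, Int.fract]
  have hx : (2:ℝ)^(m+1) * ν = 2 * (2^m * ν) := by ring
  have hpos : (2:ℝ)^m ≠ 0 := by positivity
  have hlo := Int.floor_le ((2:ℝ)^m * ν)
  have hhi := Int.lt_floor_add_one ((2:ℝ)^m * ν)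
  rw [hx]
  set x : ℝ := 2^m * ν with hxdef
  set k : ℤ := ⌊x⌋ with hk
  have hmul (s : ℝ) : s * 2^m * ν = s * x := by rw [hxdef]; ring
  simp only [hmul]
  have a1 : 1 / (2:ℝ)^m + (k : ℝ) / 2^m = ((k : ℝ) + 1) / 2^m := by ring
  have a2 : 1 / (2:ℝ)^(m+1) + (k : ℝ) / 2^m = (2 * (k : ℝ) + 1) / 2^(m+1) := by
    field_simp; ring
  rw [a1, a2]
  rcases lt_or_ge x (k + 1/2) with h | h
  · have hr : ⌊2 * x⌋ = 2 * k := by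
      rw [Int.floor_eq_iff]; push_cast; constructor <;> linarith
    have hf : ⌊(((2 * k : ℤ) : ℝ) + 1) / 2⌋ = k := by
      rw [Int.floor_eq_iff]; push_cast; constructor <;> linarith
    have hev : (-1:ℝ)^(2*k) = 1 := (even_two_mul k).neg_one_zpow
    have hod : (-1:ℝ)^(2*k+1) = -1 := (odd_two_mul_add_one k).neg_one_zpow
    rw [hr, hf, hev, hod]
    have b1 : (((2 * k : ℤ) : ℝ)) / 2^(m+1) = (k : ℝ) / 2^m := by
      push_cast; field_simp; ring
    have b2 : (((2 * k : ℤ) : ℝ) + 1) / 2^(m+1) = (2 * (k : ℝ) + 1) / 2^(m+1) := by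
      push_cast; ring
    rw [b1, b2]
    push_cast
    module
  · have hr : ⌊2 * x⌋ = 2 * k + 1 := by
      rw [Int.floor_eq_iff]; push_cast; constructor <;> linarith
    have hf : ⌊(((2 * k + 1 : ℤ) : ℝ) + 1) / 2⌋ = k + 1 := by
      rw [Int.floor_eq_iff]; push_cast; constructor <;> linarith
    have hod : (-1:ℝ)^(2*k+1) = -1 := (odd_two_mul_add_one k).neg_one_zpow
    have hev : (-1:ℝ)^(2*k+1+1) = 1 := (odd_two_mul_add_one k).add_one.neg_one_zpow
    rw [hr, hf, hev, hod]
    have b1 : (((2 * k + 1 : ℤ) : ℝ)) / 2^(m+1) = (2 * (k : ℝ) + 1) / 2^(m+1) := by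
      push_cast; ring
    have b2 : (((2 * k + 1 : ℤ) : ℝ) + 1) / 2^(m+1) = ((k : ℝ) + 1) / 2^m := by
      push_cast; field_simp; ring
    rw [b1, b2]
    push_cast
    module

lemma sum_second_diff_eq_dyadicInterp {E : Type*} [AddCommGroup E] [Module ℝ E]
    (f : ℝ → E) (N : ℕ) (ν : ℝ) :
    ∑ j ∈ Finset.Icc 1 N, sj j ν • (f ((kj j ν : ℝ)/2^(j-1))
            + f ((2:ℝ)^((1:ℤ) - j) + (kj j ν : ℝ)/2^(j-1))
            - (2:ℝ) • f ((2:ℝ)^(-(j:ℤ)) + (kj j ν : ℝ)/2^(j-1)))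
      = dyadicInterp f 0 ν - dyadicInterp f N ν := by
  induction N with
  | zero => simp
  | succ m ih =>
    rw [Finset.sum_Icc_succ_top (by omega), ih, ← dyadicInterp_sub_succ]
    abel

lemma dyadicInterp_zero {E : Type*} [AddCommGroup E] [Module ℝ E]
    (f : ℝ → E) {ν : ℝ} (h0 : 0 ≤ ν) (h1 : ν ≤ 1) :
    dyadicInterp f 0 ν = (1 - ν) • f 0 + ν • f 1 := by
  rcases h1.lt_or_eq with h | rfl
  · have hf : ⌊ν⌋ = 0 := by rw [Int.floor_eq_iff]; simp [h0, h]
    simp [dyadicInterp, Int.fract, hf]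
  · simp [dyadicInterp]

lemma rpow_weighted_le {x : ℝ} (hx : 0 < x) (u p q : ℝ) (hu0 : 0 ≤ u) (hu1 : u ≤ 1) :
    x ^ ((1 - u) * p + u * q) ≤ (1 - u) * x ^ p + u * x ^ q := by
  have h := Real.geom_mean_le_arith_mean2_weighted (sub_nonneg.2 hu1) hu0
    (rpow_nonneg hx.le p) (rpow_nonneg hx.le q) (by ring)
  rwa [← rpow_mul hx.le, ← rpow_mul hx.le, ← rpow_add hx, mul_comm p, mul_comm q] at h

section Matrices

variable {n : Type*} [Fintype n] [DecidableEq n]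

lemma spectrum_continuousOn (A : Matrix n n ℂ) (f : ℝ → ℝ) :
    ContinuousOn f (spectrum ℝ A) :=
  A.finite_real_spectrum.continuousOn f

lemma mpow_isHermitian (A : Matrix n n ℂ) (t : ℝ) : (mpow A t).IsHermitian :=
  cfc_predicate (R := ℝ) (p := IsSelfAdjoint) _ A

lemma spectrum_pos_of_posDef {A : Matrix n n ℂ} (hA : A.PosDef) {x : ℝ}
    (hx : x ∈ spectrum ℝ A) : 0 < x := by
  rw [hA.isHermitian.spectrum_real_eq_range_eigenvalues] at hx
  obtain ⟨i, rfl⟩ := hx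
  exact hA.eigenvalues_pos i

lemma mpow_zero {A : Matrix n n ℂ} (hA : A.PosDef) : mpow A 0 = 1 := by
  have : IsSelfAdjoint A := hA.isHermitian
  simp only [mpow, rpow_zero]
  exact cfc_const_one ℝ A

lemma mpow_one {A : Matrix n n ℂ} (hA : A.PosDef) : mpow A 1 = A := by
  have : IsSelfAdjoint A := hA.isHermitian
  simp only [mpow, rpow_one]
  exact cfc_id' ℝ A

lemma mpow_mul_mpow {A : Matrix n n ℂ} (hA : A.PosDef) (s t : ℝ) :
    mpow A s * mpow A t = mpow A (s + t) := by
  unfold mpow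
  rw [← cfc_mul _ _ A (spectrum_continuousOn A _) (spectrum_continuousOn A _)]
  exact cfc_congr fun x hx => (rpow_add (spectrum_pos_of_posDef hA hx) s t).symm

lemma mpow_conj_posDef {A B : Matrix n n ℂ} (hA : A.PosDef) (hB : B.PosDef) (t : ℝ) :
    (mpow A t * B * mpow A t).PosDef := by
  have hu : IsUnit (mpow A t) := by
    refine ⟨⟨mpow A t, mpow A (-t), ?_, ?_⟩, rfl⟩ <;>
      simp [mpow_mul_mpow hA, mpow_zero hA]
  have h := (Matrix.IsUnit.posDef_star_left_conjugate_iff (x := B) hu).2 hB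
  rwa [Matrix.star_eq_conjTranspose, (mpow_isHermitian A t).eq] at h

lemma gm_zero {A B : Matrix n n ℂ} (hA : A.PosDef) (hB : B.PosDef) : gm A B 0 = A := by
  rw [gm, mpow_zero (mpow_conj_posDef hA hB _), mul_one, mpow_mul_mpow hA]
  norm_num [mpow_one hA]

lemma gm_one {A B : Matrix n n ℂ} (hA : A.PosDef) (hB : B.PosDef) : gm A B 1 = B := by
  rw [gm, mpow_one (mpow_conj_posDef hA hB _)]
  have h1 : mpow A (1/2) * mpow A (-(1/2)) = 1 := by
    rw [mpow_mul_mpow hA, add_neg_cancel, mpow_zero hA]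
  have h2 : mpow A (-(1/2)) * mpow A (1/2) = 1 := by
    rw [mpow_mul_mpow hA, neg_add_cancel, mpow_zero hA]
  rw [← mul_assoc, ← mul_assoc, h1, one_mul, mul_assoc, h2, mul_one]

lemma mpow_convex {C : Matrix n n ℂ} (hC : C.PosDef) (u p q : ℝ) (hu0 : 0 ≤ u) (hu1 : u ≤ 1) :
    ((1 - u) • mpow C p + u • mpow C q - mpow C ((1 - u) * p + u * q)).PosSemidef := by
  have h := spectrum_continuousOn C
  unfold mpow
  rw [← Matrix.nonneg_iff_posSemidef, sub_nonneg, ← cfc_smul _ _ C (h _), ← cfc_smul _ _ C (h _),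
    ← cfc_add _ _ _ (h _) (h _)]
  refine cfc_mono (fun x hx => ?_) (h _) (h _)
  exact rpow_weighted_le (spectrum_pos_of_posDef hC hx) u p q hu0 hu1

lemma gm_convex {A B : Matrix n n ℂ} (hA : A.PosDef) (hB : B.PosDef)
    (u p q : ℝ) (hu0 : 0 ≤ u) (hu1 : u ≤ 1) :
    ((1 - u) • gm A B p + u • gm A B q - gm A B ((1 - u) * p + u * q)).PosSemidef := by
  have h := (mpow_convex (mpow_conj_posDef hA hB (-(1/2))) u p q hu0 hu1).mul_mul_conjTranspose_same
    (mpow A (1/2))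
  rw [(mpow_isHermitian A (1/2)).eq] at h
  simpa only [gm, mul_sub, sub_mul, mul_add, add_mul, mul_smul_comm, smul_mul_assoc] using h

lemma gm_le_dyadicInterp {A B : Matrix n n ℂ} (hA : A.PosDef) (hB : B.PosDef) (N : ℕ) (ν : ℝ) :
    (dyadicInterp (gm A B) N ν - gm A B ν).PosSemidef := by
  have h := gm_convex hA hB (Int.fract ((2:ℝ)^N * ν)) ((⌊(2:ℝ)^N * ν⌋ : ℝ) / 2^N)
    (((⌊(2:ℝ)^N * ν⌋ : ℝ) + 1) / 2^N) (Int.fract_nonneg _) (Int.fract_lt_one _).le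
  have e : (1 - Int.fract ((2:ℝ)^N * ν)) * ((⌊(2:ℝ)^N * ν⌋ : ℝ) / 2^N)
      + Int.fract ((2:ℝ)^N * ν) * (((⌊(2:ℝ)^N * ν⌋ : ℝ) + 1) / 2^N) = ν := by
    rw [Int.fract]
    field_simp
    ring
  rwa [e] at h

end Matrices

theorem stmt16 {n : Type*} [Fintype n] [DecidableEq n]
    (A B : Matrix n n ℂ) (hA : A.PosDef) (hB : B.PosDef)
    (N : ℕ) (ν : ℝ) (h0 : 0 ≤ ν) (h1 : ν ≤ 1) :
    (((1 - ν) • A + ν • B)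
      - (gm A B ν + ∑ j ∈ Finset.Icc 1 N, sj j ν •
          (gm A B ((kj j ν : ℝ)/2^(j-1))
            + gm A B ((2:ℝ)^((1:ℤ) - j) + (kj j ν : ℝ)/2^(j-1))
            - (2:ℝ) • gm A B ((2:ℝ)^(-(j:ℤ)) + (kj j ν : ℝ)/2^(j-1))))).PosSemidef := by
  rw [sum_second_diff_eq_dyadicInterp (gm A B) N ν, dyadicInterp_zero _ h0 h1, gm_zero hA hB,
    gm_one hA hB]
  convert gm_le_dyadicInterp hA hB N ν using 1
  abel
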